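/- arXiv:1005.3256 — 3 statements merged into one kernel-verified Lean document; each statement's English description precedes it below -/
import Mathlib

section
/- Let μ be a measure (finitely supported, nonnegative) on ℤ × ℤ such that the total mass (D₀μ)(Γ) is nonzero. Then the expected value of the function a−b with respect to D₀μ equals m/2. -/
open Finsupp Filter

noncomputable section

/-- Signed-sum convention: `signedSum c k = Σ_{i=0}^{k} c i`, which is the ordinary sum for
`k ≥ 0`, is `0` for `k = -1`, and equals `-(c (-1) + c (-2) + ⋯ + c (k+1))` for `k ≤ -2`. -/
def signedSum {M : Type*} [AddCommGroup M] (c : ℤ → M) (k : ℤ) : M :=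
  (∑ i ∈ Finset.range (k + 1).toNat, c i) -
    ∑ i ∈ Finset.range (-(k + 1)).toNat, c (-((i : ℤ) + 1))

/-- The Demazure operator `D₀` (relative to `Λ = mΛ₀ + nΛ₁`):
`D₀ δ_{(a,b)} = Σ_{i=0}^{m - 2(a-b)} δ_{(a+i,b)}`, extended ℤ-linearly. -/
def D0 (m : ℕ) (μ : ℤ × ℤ →₀ ℤ) : ℤ × ℤ →₀ ℤ :=
  μ.sum fun p c =>
    c • signedSum (fun i => Finsupp.single (p.1 + i, p.2) (1 : ℤ)) ((m : ℤ) - 2 * (p.1 - p.2))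

/-- The Demazure operator `D₁` (relative to `Λ = mΛ₀ + nΛ₁`):
`D₁ δ_{(a,b)} = Σ_{i=0}^{n + 2(a-b)} δ_{(a,b+i)}`, extended ℤ-linearly. -/
def D1 (n : ℕ) (μ : ℤ × ℤ →₀ ℤ) : ℤ × ℤ →₀ ℤ :=
  μ.sum fun p c =>
    c • signedSum (fun i => Finsupp.single (p.1, p.2 + i) (1 : ℤ)) ((n : ℤ) + 2 * (p.1 - p.2))

/-- Total mass `μ(Γ)` of a finitely supported function on `ℤ × ℤ`. -/
def mass (μ : ℤ × ℤ →₀ ℤ) : ℤ := μ.sum fun _ c => c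

/-- Expected value `E_ν[f] = (1/ν(Γ)) Σ ν(a,b) f(a,b)`. -/
def expVal (ν : ℤ × ℤ →₀ ℤ) (f : ℤ × ℤ → ℚ) : ℚ :=
  (mass ν : ℚ)⁻¹ * ν.sum fun p c => (c : ℚ) * f p

/-- Covariance `Cov_ν(f,g) = E_ν[f·g] - E_ν[f]·E_ν[g]`. -/
def cov (ν : ℤ × ℤ →₀ ℤ) (f g : ℤ × ℤ → ℚ) : ℚ :=
  expVal ν (fun p => f p * g p) - expVal ν f * expVal ν g

/-- Variance `Var_ν(f) = Cov_ν(f,f)`. -/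
def var (ν : ℤ × ℤ →₀ ℤ) (f : ℤ × ℤ → ℚ) : ℚ := cov ν f f

/-- The coordinate function `a` (the degree). -/
def fa : ℤ × ℤ → ℚ := fun p => (p.1 : ℚ)

/-- The coordinate function `b`. -/
def fb : ℤ × ℤ → ℚ := fun p => (p.2 : ℚ)

/-- The finite-weight coordinate `a - b`. -/
def fab : ℤ × ℤ → ℚ := fun p => (p.1 : ℚ) - (p.2 : ℚ)

/-- `μ_{N,0}`: start from `δ_{(0,0)}`, apply `D₀` at odd steps and `D₁` at even steps. -/
def mu0 (m n : ℕ) : ℕ → (ℤ × ℤ →₀ ℤ)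
  | 0 => Finsupp.single (0, 0) 1
  | N + 1 => if N % 2 = 0 then D0 m (mu0 m n N) else D1 n (mu0 m n N)

/-- `μ_{N,1}`: start from `δ_{(0,0)}`, apply `D₁` at odd steps and `D₀` at even steps. -/
def mu1 (m n : ℕ) : ℕ → (ℤ × ℤ →₀ ℤ)
  | 0 => Finsupp.single (0, 0) 1
  | N + 1 => if N % 2 = 0 then D1 n (mu1 m n N) else D0 m (mu1 m n N)

/-- The functional `ν ↦ Σ ν(p) f(p)` as an additive homomorphism. -/
def weightedSum (f : ℤ × ℤ → ℚ) : (ℤ × ℤ →₀ ℤ) →+ ℚ :=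
  Finsupp.liftAddHom fun p => (AddMonoidHom.mulRight (f p)).comp (Int.castAddHom ℚ)

lemma weightedSum_apply (f : ℤ × ℤ → ℚ) (ν : ℤ × ℤ →₀ ℤ) :
    weightedSum f ν = ν.sum fun p c => (c : ℚ) * f p := rfl

lemma weightedSum_single (f : ℤ × ℤ → ℚ) (p : ℤ × ℤ) (c : ℤ) :
    weightedSum f (Finsupp.single p c) = c * f p := by
  simp [weightedSum_apply]

lemma map_signedSum {M N : Type*} [AddCommGroup M] [AddCommGroup N] (φ : M →+ N)
    (c : ℤ → M) (k : ℤ) : φ (signedSum c k) = signedSum (fun i => φ (c i)) k := by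
  simp [signedSum]

lemma sum_range_two_mul_add_one_sub (N : ℕ) :
    ∑ i ∈ Finset.range N, (2 * (i : ℚ) + 1) = (N : ℚ) ^ 2 := by
  induction N with
  | zero => simp
  | succ k ih => rw [Finset.sum_range_succ, ih]; push_cast; ring

/-- The signed string `0, …, k` is centred at `k / 2`. -/
lemma signedSum_two_mul_sub_self (k : ℤ) :
    signedSum (fun i => 2 * (i : ℚ) - k) k = 0 := by
  have pos (N : ℕ) : ∑ i ∈ Finset.range N, (2 * (i : ℚ) + 1 - N) = 0 := by
    rw [Finset.sum_sub_distrib, sum_range_two_mul_add_one_sub]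
    simp [sq]
  rcases le_total 0 (k + 1) with hk | hk
  · obtain ⟨N, hN⟩ := Int.eq_ofNat_of_zero_le hk
    obtain rfl : k = N - 1 := by omega
    rw [signedSum, show ((N : ℤ) - 1 + 1).toNat = N by omega,
      show (-((N : ℤ) - 1 + 1)).toNat = 0 by omega, Finset.sum_range_zero, sub_zero, ← pos N]
    refine Finset.sum_congr rfl fun i _ => ?_
    push_cast; ring
  · obtain ⟨N, hN⟩ := Int.eq_ofNat_of_zero_le (neg_nonneg.mpr hk)
    obtain rfl : k = -N - 1 := by omega
    rw [signedSum, show (-(N : ℤ) - 1 + 1).toNat = 0 by omega,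
      show (-(-(N : ℤ) - 1 + 1)).toNat = N by omega, Finset.sum_range_zero, zero_sub, ← pos N,
      ← Finset.sum_neg_distrib]
    refine Finset.sum_congr rfl fun i _ => ?_
    push_cast; ring

/-- `D₀μ` is balanced around `a - b = m / 2`. -/
lemma weightedSum_D0 (m : ℕ) (μ : ℤ × ℤ →₀ ℤ) :
    weightedSum (fun p => 2 * fab p - m) (D0 m μ) = 0 := by
  rw [D0, Finsupp.sum, map_sum]
  refine Finset.sum_eq_zero fun p _ => ?_
  rw [map_zsmul, map_signedSum]
  convert smul_zero _
  rw [← signedSum_two_mul_sub_self ((m : ℤ) - 2 * (p.1 - p.2))]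
  congr 1
  funext i
  rw [weightedSum_single, fab]
  push_cast; ring

/-- For a nonnegative finitely supported measure `μ` on `ℤ × ℤ` with
`(D₀μ)(Γ) ≠ 0`, the expected value of `a - b` with respect to `D₀μ` equals `m/2`. -/
theorem stmt_0 (m : ℕ) (μ : ℤ × ℤ →₀ ℤ) (hpos : ∀ p, 0 ≤ μ p)
    (h : mass (D0 m μ) ≠ 0) :
    expVal (D0 m μ) fab = (m : ℚ) / 2 := by
  have h_mass : (mass (D0 m μ) : ℚ) ≠ 0 := by exact_mod_cast h
  have h_bal := weightedSum_D0 m μ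
  have h_split : weightedSum (fun p => 2 * fab p - m) (D0 m μ) =
      2 * (D0 m μ).sum (fun p c => (c : ℚ) * fab p) - m * mass (D0 m μ) := by
    simp only [weightedSum_apply, mass, Finsupp.sum, Int.cast_sum, Finset.mul_sum,
      ← Finset.sum_sub_distrib]
    exact Finset.sum_congr rfl fun p _ => by ring
  rw [expVal]
  field_simp
  linarith
end
end

section
/- Let μ be a measure (finitely supported, nonnegative) on ℤ × ℤ with μ(Γ) ≠ 0 and (D₁μ)(Γ) ≠ 0, and let k ≥ 0 be an integer. Then E_{D₁μ}[a^k] = (μ(Γ)/(D₁μ)(Γ)) · E_μ[a^k · (n + 1 + 2(a−b))]. -/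
open Finsupp Filter

noncomputable section

lemma signedSum_const {R : Type*} [Ring R] (q : R) (k : ℤ) :
    signedSum (fun _ => q) k = ((k + 1 : ℤ) : R) * q := by
  have h : ((k + 1).toNat : ℤ) - ((-(k + 1)).toNat : ℤ) = k + 1 := by omega
  rw [← h, Int.cast_sub, Int.cast_natCast, Int.cast_natCast, sub_mul]
  simp only [signedSum, Finset.sum_const, Finset.card_range, nsmul_eq_mul]

/-- Integration of `f` against a finitely supported integer-valued function. -/
def integralHom (f : ℤ × ℤ → ℚ) : (ℤ × ℤ →₀ ℤ) →+ ℚ :=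
  Finsupp.liftAddHom fun p => (AddMonoidHom.mulRight (f p)).comp (Int.castAddHom ℚ)

lemma integralHom_apply (f : ℤ × ℤ → ℚ) (ν : ℤ × ℤ →₀ ℤ) :
    integralHom f ν = ν.sum fun p c => (c : ℚ) * f p := rfl

lemma integralHom_single (f : ℤ × ℤ → ℚ) (p : ℤ × ℤ) (c : ℤ) :
    integralHom f (Finsupp.single p c) = c * f p := by
  simp [integralHom_apply]

/-- The integral of a function of the degree against `D₁ μ` is its integral against `μ`
weighted by `n + 1 + 2(a-b)`. -/
lemma integralHom_D1 (n : ℕ) (μ : ℤ × ℤ →₀ ℤ) (g : ℤ → ℚ) :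
    integralHom (fun p => g p.1) (D1 n μ) =
      integralHom (fun p => g p.1 * ((n : ℚ) + 1 + 2 * fab p)) μ := by
  rw [D1, map_finsuppSum, integralHom_apply]
  refine Finsupp.sum_congr fun p _ => ?_
  rw [map_zsmul, map_signedSum]
  simp only [integralHom_single, signedSum_const, fab, zsmul_eq_mul]
  push_cast
  ring

/-- `E_{D₁μ}[a^k] = (μ(Γ)/(D₁μ)(Γ)) · E_μ[a^k (n+1+2(a-b))]`. -/
theorem stmt_2 (n : ℕ) (μ : ℤ × ℤ →₀ ℤ) (hpos : ∀ p, 0 ≤ μ p)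
    (h0 : mass μ ≠ 0) (h1 : mass (D1 n μ) ≠ 0) (k : ℕ) :
    expVal (D1 n μ) (fun p => fa p ^ k) =
      (mass μ : ℚ) / (mass (D1 n μ) : ℚ) *
        expVal μ (fun p => fa p ^ k * ((n : ℚ) + 1 + 2 * fab p)) := by
  have h0' : (mass μ : ℚ) ≠ 0 := Int.cast_ne_zero.mpr h0
  have key := integralHom_D1 n μ fun a => (a : ℚ) ^ k
  simp only [integralHom_apply] at key
  simp only [expVal, fa]
  rw [key, div_mul_eq_mul_div, mul_inv_cancel_left₀ h0', div_eq_inv_mul]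
end
end

section
/- Let μ be a measure (finitely supported, nonnegative) on ℤ × ℤ with (D₁μ)(Γ) ≠ 0. Then Cov_{D₁μ}(a, a−b) = 0 and Cov_{D₁μ}(b, a−b) = −Var_{D₁μ}(a−b). -/
open Finsupp Filter

noncomputable section

/-- Pairing `Σ ν(p) f(p)` of a finitely supported function with `f`, as an additive map in `ν`. -/
def pairing (f : ℤ × ℤ → ℚ) : (ℤ × ℤ →₀ ℤ) →+ ℚ :=
  Finsupp.liftAddHom fun p => (AddMonoidHom.mulRight (f p)).comp (Int.castAddHom ℚ)

lemma pairing_apply (f : ℤ × ℤ → ℚ) (ν : ℤ × ℤ →₀ ℤ) :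
    pairing f ν = ν.sum fun p c => (c : ℚ) * f p := rfl

lemma pairing_single (f : ℤ × ℤ → ℚ) (p : ℤ × ℤ) (c : ℤ) :
    pairing f (Finsupp.single p c) = c * f p := by
  simp [pairing_apply]

lemma sum_range_mul_sub_two_mul (r x : ℚ) (m : ℕ) :
    ∑ i ∈ Finset.range m, r * (x - 2 * i) = r * (m * (x - (m - 1))) := by
  induction m with
  | zero => simp
  | succ m ih => rw [Finset.sum_range_succ, ih]; push_cast; ring

/-- A string of length `k` is symmetric about its midpoint. -/
lemma signedSum_mul_sub_two_mul (r : ℚ) (k : ℤ) :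
    signedSum (fun i => r * ((k : ℚ) - 2 * i)) k = 0 := by
  unfold signedSum
  have hneg : ∀ i : ℕ, r * ((k : ℚ) - 2 * ((-((i : ℤ) + 1) : ℤ) : ℚ)) =
      -r * ((-k - 2) - 2 * i) := fun i => by push_cast; ring
  simp only [hneg, Int.cast_natCast, sum_range_mul_sub_two_mul]
  rcases le_total 0 (k + 1) with hk | hk
  · have h1 : ((k + 1).toNat : ℚ) = k + 1 := by exact_mod_cast Int.toNat_of_nonneg hk
    rw [h1, Int.toNat_of_nonpos (by omega : -(k + 1) ≤ 0)]
    push_cast; ring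
  · have h1 : ((-(k + 1)).toNat : ℚ) = -(k + 1) := by
      exact_mod_cast Int.toNat_of_nonneg (by omega : 0 ≤ -(k + 1))
    rw [h1, Int.toNat_of_nonpos hk]
    push_cast; ring

/-- After `D₁`, the weight `n + 2(a - b)` is orthogonal to every function of `a`. -/
lemma pairing_D1_eq_zero (n : ℕ) (μ : ℤ × ℤ →₀ ℤ) (g : ℤ → ℚ) :
    pairing (fun p => g p.1 * (n + 2 * fab p)) (D1 n μ) = 0 := by
  unfold D1
  rw [Finsupp.sum, map_sum]
  refine Finset.sum_eq_zero fun p _ => ?_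
  rw [map_zsmul, map_signedSum]
  convert smul_zero _
  convert signedSum_mul_sub_two_mul (g p.1) ((n : ℤ) + 2 * (p.1 - p.2)) using 3 with i
  rw [pairing_single]
  simp only [fab]
  push_cast
  ring

lemma expVal_eq_pairing (ν : ℤ × ℤ →₀ ℤ) (f : ℤ × ℤ → ℚ) :
    expVal ν f = (mass ν : ℚ)⁻¹ * pairing f ν := rfl

lemma expVal_add (ν : ℤ × ℤ →₀ ℤ) (f g : ℤ × ℤ → ℚ) :
    expVal ν (fun p => f p + g p) = expVal ν f + expVal ν g := by
  simp only [expVal, mul_add, Finsupp.sum, Finset.sum_add_distrib]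

lemma expVal_const_mul (ν : ℤ × ℤ →₀ ℤ) (r : ℚ) (f : ℤ × ℤ → ℚ) :
    expVal ν (fun p => r * f p) = r * expVal ν f := by
  simp only [expVal, Finsupp.sum, Finset.mul_sum]
  exact Finset.sum_congr rfl fun p _ => by ring

lemma expVal_one (ν : ℤ × ℤ →₀ ℤ) (h : mass ν ≠ 0) : expVal ν (fun _ => 1) = 1 := by
  have h' : (mass ν : ℚ) ≠ 0 := by exact_mod_cast h
  have : (ν.sum fun _ c => (c : ℚ) * 1) = mass ν := by simp [mass, Finsupp.sum]
  rw [expVal, this, inv_mul_cancel₀ h']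

lemma cov_add_left (ν : ℤ × ℤ →₀ ℤ) (f g k : ℤ × ℤ → ℚ) :
    cov ν (fun p => f p + g p) k = cov ν f k + cov ν g k := by
  simp only [cov, add_mul, expVal_add]
  ring

/-- Under `D₁μ`, the conditional mean of `a - b` given `a` is `-n/2`. -/
lemma expVal_D1_mul_fab (n : ℕ) (μ : ℤ × ℤ →₀ ℤ) (g : ℤ → ℚ) :
    expVal (D1 n μ) (fun p => g p.1 * fab p) =
      -(n / 2) * expVal (D1 n μ) (fun p => g p.1) := by
  have h0 : expVal (D1 n μ) (fun p => g p.1 * (n + 2 * fab p)) = 0 := by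
    rw [expVal_eq_pairing, pairing_D1_eq_zero, mul_zero]
  have hsplit : (fun p : ℤ × ℤ => g p.1 * (n + 2 * fab p)) =
      fun p => (n : ℚ) * g p.1 + 2 * (g p.1 * fab p) := by
    funext p; ring
  rw [hsplit, expVal_add, expVal_const_mul, expVal_const_mul] at h0
  linarith

/-- `Cov_{D₁μ}(a, a-b) = 0` and `Cov_{D₁μ}(b, a-b) = -Var_{D₁μ}(a-b)`. -/
theorem stmt_10 (n : ℕ) (μ : ℤ × ℤ →₀ ℤ) (hpos : ∀ p, 0 ≤ μ p)
    (h : mass (D1 n μ) ≠ 0) :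
    cov (D1 n μ) fa fab = 0 ∧ cov (D1 n μ) fb fab = -var (D1 n μ) fab := by
  have hE : expVal (D1 n μ) fab = -(n / 2) := by
    simpa [expVal_one _ h] using expVal_D1_mul_fab n μ fun _ => 1
  have hcov : cov (D1 n μ) fa fab = 0 := by
    have hmul := expVal_D1_mul_fab n μ fun a => (a : ℚ)
    change expVal (D1 n μ) (fun p => fa p * fab p) = -(n / 2) * expVal (D1 n μ) fa at hmul
    rw [cov, hmul, hE]
    ring
  refine ⟨hcov, ?_⟩
  have hfa : fa = fun p => fb p + fab p := by
    funext p
    simp only [fa, fb, fab]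
    ring
  have hsum : cov (D1 n μ) fb fab + cov (D1 n μ) fab fab = 0 := by
    rw [← cov_add_left, ← hfa, hcov]
  rw [var]
  linarith
end
end
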